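/- For every r > 2 there is a constant C depending only on r such that the following holds for all ε ∈ (0,1], t ∈ [0,ε], τ > 0. Let w̄ = (w̄_ξ)_{ξ∈ℝ} be a family of twice continuously differentiable functions w̄_ξ : [0,∞) → ℂ for which all norms below are finite and all integrals converge absolutely. Define ∂_y𝒩_ξ(y) = i∫_ℝ ( w̄_η(y)(ξ−η)∂_y w̄_{ξ−η}(y) − η I_y[w̄_η] ∂_{yy} w̄_{ξ−η}(y) ) dη and T_{∂y𝒩} = ∫_ℝ∫_0^∞ ∂_y𝒩_ξ(y) conj(∂_y w̄_ξ(y)) χ(y)² ρ(y)² e^{2τ|ξ|} ⟨ξ⟩^{2r−1} dy dξ. Then |T_{∂y𝒩}| ≤ C ( ‖⟨∂ₓ⟩^{1/2} χ∂_y w̄‖²_{τ,r−1/2} ‖∂_y w̄‖_{τ,r} + ‖χ∂_{yy} w̄‖_{τ,r−1/2} ‖χ∂_y w̄‖_{τ,r−1/2} ‖⟨∂ₓ⟩^{1/2} w̄‖_{τ,r} ). -/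

import Mathlib

open MeasureTheory Set Filter

noncomputable section

/-- Gaussian weight `ρ(y) = exp(y²/(8(1+t/ε)))`. -/
def rho (ε t y : ℝ) : ℝ := Real.exp (y ^ 2 / (8 * (1 + t / ε)))

/-- Japanese bracket `⟨ξ⟩ = √(1+ξ²)`. -/
def brak (ξ : ℝ) : ℝ := Real.sqrt (1 + ξ ^ 2)

/-- Combined weight `ρ(y)² e^{2τ|ξ|} ⟨ξ⟩^{2s}` in the squared analytic norms. -/
def wgt (ε t τ s ξ y : ℝ) : ℝ :=
  (rho ε t y) ^ 2 * Real.exp (2 * τ * |ξ|) * brak ξ ^ (2 * s)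

/-- Weight `e^{2τ|ξ|} ⟨ξ⟩^{2s}` for the squared analytic norms of boundary data. -/
def aWgt (τ s ξ : ℝ) : ℝ := Real.exp (2 * τ * |ξ|) * brak ξ ^ (2 * s)

/-- Analytic norm `‖w‖_{τ,s}` (with Fourier multiplier `m`):
`(∫_ℝ ∫_0^∞ m(ξ) ρ(y)² |w_ξ(y)|² e^{2τ|ξ|} ⟨ξ⟩^{2s} dy dξ)^{1/2}`. -/
def wNorm (ε t τ s : ℝ) (m : ℝ → ℝ) (w : ℝ → ℝ → ℂ) : ℝ :=
  Real.sqrt (∫ ξ : ℝ, ∫ y in Ioi (0 : ℝ), m ξ * ‖w ξ y‖ ^ 2 * wgt ε t τ s ξ y)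

/-- Analytic norm `‖A‖~_{τ,s}` (with Fourier multiplier `m`):
`(∫_ℝ m(ξ) |A_ξ|² e^{2τ|ξ|} ⟨ξ⟩^{2s} dξ)^{1/2}`. -/
def aNorm (τ s : ℝ) (m : ℝ → ℝ) (A : ℝ → ℂ) : ℝ :=
  Real.sqrt (∫ ξ : ℝ, m ξ * ‖A ξ‖ ^ 2 * aWgt τ s ξ)

/-- Finiteness of the squared norm `‖·‖_{τ,s}` with multiplier `m`. -/
def wFinite (ε t τ s : ℝ) (m : ℝ → ℝ) (w : ℝ → ℝ → ℂ) : Prop :=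
  Integrable (fun p : ℝ × ℝ => m p.1 * ‖w p.1 p.2‖ ^ 2 * wgt ε t τ s p.1 p.2)
    ((volume : Measure ℝ).prod ((volume : Measure ℝ).restrict (Ioi 0)))

/-- Finiteness of the squared norm `‖·‖~_{τ,s}` with multiplier `m`. -/
def aFinite (τ s : ℝ) (m : ℝ → ℝ) (A : ℝ → ℂ) : Prop :=
  Integrable (fun ξ : ℝ => m ξ * ‖A ξ‖ ^ 2 * aWgt τ s ξ) (volume : Measure ℝ)

/-- `I_y[h] = ∫_0^y h`. -/
def Iy (h : ℝ → ℂ) (y : ℝ) : ℂ := ∫ y' in (0 : ℝ)..y, h y'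

/-- The differentiated quadratic term
`∂_y𝒩_ξ(y) = i∫ (w̄_η (ξ−η) ∂_y w̄_{ξ−η} − η I_y[w̄_η] ∂_{yy} w̄_{ξ−η}) dη`. -/
def dyNcal (w : ℝ → ℝ → ℂ) (ξ y : ℝ) : ℂ :=
  Complex.I * ∫ η : ℝ,
    (w η y * ((ξ - η : ℝ) : ℂ) * deriv (w (ξ - η)) y
      - (η : ℂ) * Iy (w η) y * deriv (deriv (w (ξ - η))) y)

/-- L2 norm in ENNReal -/
def nn {α : Type*} [MeasurableSpace α] (μ : Measure α) (f : α → ENNReal) : ENNReal :=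
  (∫⁻ x, f x ^ (2:ℝ) ∂μ) ^ (1 / 2 : ℝ)

theorem cs {α : Type*} [MeasurableSpace α] (μ : Measure α) {f g : α → ENNReal}
    (hf : AEMeasurable f μ) (hg : AEMeasurable g μ) :
    ∫⁻ x, f x * g x ∂μ ≤ nn μ f * nn μ g :=
  ENNReal.lintegral_mul_le_Lp_mul_Lq μ Real.HolderConjugate.two_two hf hg

theorem young1 {f g h : ℝ → ENNReal} (hf : AEMeasurable f) (hg : AEMeasurable g)
    (hh : AEMeasurable h) :
    ∫⁻ ξ, ∫⁻ η, f η * g (ξ - η) * h ξ ≤ (∫⁻ η, f η) * (nn volume g * nn volume h) := by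
  have hg2 : AEMeasurable (fun p : ℝ × ℝ => g (p.1 - p.2)) (volume.prod volume) :=
    hg.comp_quasiMeasurePreserving (quasiMeasurePreserving_sub volume volume)
  rw [lintegral_lintegral_swap]
  · have : ∀ η, ∫⁻ ξ, f η * g (ξ - η) * h ξ ≤ f η * (nn volume g * nn volume h) := by
      intro η
      have hgη : AEMeasurable (fun ξ => g (ξ - η)) :=
        hg.comp_quasiMeasurePreserving (measurePreserving_sub_right volume η).quasiMeasurePreserving
      simp_rw [mul_assoc]
      rw [lintegral_const_mul'' (f η) (f := fun ξ => g (ξ - η) * h ξ) (hgη.mul hh)]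
      gcongr
      refine (cs _ hgη hh).trans (le_of_eq ?_)
      congr 1
      unfold nn
      rw [lintegral_sub_right_eq_self (fun ξ => g ξ ^ (2:ℝ)) η]
    refine (lintegral_mono this).trans (le_of_eq ?_)
    rw [lintegral_mul_const'' _ hf]
  · exact ((hf.comp_snd).mul hg2).mul hh.comp_fst

theorem young2 {f g h : ℝ → ENNReal} (hf : AEMeasurable f) (hg : AEMeasurable g)
    (hh : AEMeasurable h) :
    ∫⁻ ξ, ∫⁻ η, f η * g (ξ - η) * h ξ ≤ (∫⁻ η, g η) * (nn volume f * nn volume h) := by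
  refine le_trans (le_of_eq ?_) (young1 hg hf hh)
  congr 1; ext ξ
  rw [← lintegral_sub_left_eq_self _ ξ]
  congr 1; ext η
  rw [sub_sub_cancel, mul_comm (f _)]

theorem brak_pos (x : ℝ) : 0 < brak x := Real.sqrt_pos.2 (by positivity)
theorem brak_one (x : ℝ) : 1 ≤ brak x := Real.one_le_sqrt.2 (by nlinarith [sq_nonneg x])
theorem brak_sq (x : ℝ) : brak x ^ 2 = 1 + x ^ 2 := Real.sq_sqrt (by positivity)
theorem abs_le_brak (x : ℝ) : |x| ≤ brak x := Real.abs_le_sqrt (by linarith)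
theorem brak_cont : Continuous brak := by unfold brak; fun_prop

theorem brak_add (x y : ℝ) : brak (x + y) ≤ brak x + brak y := by
  have h1 := brak_sq x
  have h2 := brak_sq y
  have h3 := brak_sq (x + y)
  have h4 := abs_le_brak x
  have h5 := abs_le_brak y
  have := brak_pos x
  have := brak_pos y
  have h6 : x * y ≤ brak x * brak y := by
    calc x * y ≤ |x * y| := le_abs_self _
      _ = |x| * |y| := abs_mul _ _
      _ ≤ _ := by gcongr
  refine le_of_sq_le_sq ?_ (by positivity) 
  nlinarith

theorem brak_add_rpow (x y p : ℝ) (hp : 0 ≤ p) :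
    brak (x + y) ^ p ≤ 2 ^ p * (brak x ^ p + brak y ^ p) := by
  have hx := brak_pos x
  have hy := brak_pos y
  have h : brak (x + y) ≤ 2 * max (brak x) (brak y) := by
    have := brak_add x y
    have := le_max_left (brak x) (brak y)
    have := le_max_right (brak x) (brak y)
    linarith
  calc brak (x + y) ^ p ≤ (2 * max (brak x) (brak y)) ^ p :=
        Real.rpow_le_rpow (brak_pos _).le h hp
    _ = 2 ^ p * (max (brak x) (brak y)) ^ p := Real.mul_rpow (by norm_num) (by positivity)
    _ ≤ _ := by
      gcongr
      have := Real.rpow_nonneg hx.le p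
      have := Real.rpow_nonneg hy.le p
      rcases max_cases (brak x) (brak y) with h | h <;> rw [h.1] <;> linarith

/-- inverse bracket -/
def ji (x : ℝ) : ENNReal := ENNReal.ofReal (brak x)⁻¹

theorem ji_meas : Measurable ji := (brak_cont.measurable.inv).ennreal_ofReal

theorem ji_nn : nn volume ji < ⊤ := by
  unfold nn
  refine ENNReal.rpow_lt_top_of_nonneg (by norm_num) (ne_of_lt ?_)
  have : ∀ x, ji x ^ (2:ℝ) = ENNReal.ofReal ((1 + x ^ 2)⁻¹) := by
    intro x
    unfold ji
    rw [ENNReal.ofReal_rpow_of_nonneg (by have := brak_pos x; positivity) (by norm_num),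
      ← brak_sq]
    norm_num
  simp_rw [this]
  exact (integrable_inv_one_add_sq).lintegral_lt_top

theorem tri {f g h : ℝ → ENNReal} (hf : AEMeasurable f) (hg : AEMeasurable g)
    (hh : AEMeasurable h) :
    ∫⁻ ξ, ∫⁻ η, f η * g (ξ - η) * h ξ * (ji η + ji (ξ - η)) ≤
      2 * nn volume ji * (nn volume f * nn volume g * nn volume h) := by
  have hg2 : ∀ ξ, AEMeasurable (fun η : ℝ => g (ξ - η)) := fun ξ =>
    hg.comp_quasiMeasurePreserving (quasiMeasurePreserving_sub_left volume ξ)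
  have hg3 : AEMeasurable (fun p : ℝ × ℝ => g (p.1 - p.2)) (volume.prod volume) :=
    hg.comp_quasiMeasurePreserving (quasiMeasurePreserving_sub volume volume)
  have hfj := hf.mul ji_meas.aemeasurable
  have hgj := hg.mul ji_meas.aemeasurable
  have e : ∀ ξ, ∫⁻ η, f η * g (ξ - η) * h ξ * (ji η + ji (ξ - η)) =
      (∫⁻ η, (f * ji) η * g (ξ - η) * h ξ) + ∫⁻ η, f η * (g * ji) (ξ - η) * h ξ := by
    intro ξ
    rw [← lintegral_add_left' (f := fun η => (f * ji) η * g (ξ - η) * h ξ)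
      ((hfj.mul (hg2 ξ)).mul_const _)]
    congr 1; ext η
    simp only [Pi.mul_apply]; ring
  simp_rw [e]
  rw [lintegral_add_left']
  · have h1 := young1 hfj hg hh
    have h2 := young2 hf hgj hh
    have h3 : ∫⁻ η, (f * ji) η ≤ nn volume f * nn volume ji := cs _ hf ji_meas.aemeasurable
    have h4 : ∫⁻ η, (g * ji) η ≤ nn volume g * nn volume ji := cs _ hg ji_meas.aemeasurable
    calc _ ≤ (nn volume f * nn volume ji) * (nn volume g * nn volume h) +
        (nn volume g * nn volume ji) * (nn volume f * nn volume h) := by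
          refine add_le_add (h1.trans ?_) (h2.trans ?_) <;> gcongr
      _ = _ := by ring
  · exact (((hfj.comp_snd).mul hg3).mul hh.comp_fst).lintegral_prod_right'

/-- frequency weight -/
def om (τ s ξ : ℝ) : ENNReal := ENNReal.ofReal (Real.exp (τ * |ξ|) * brak ξ ^ s)

theorem exp_sub (τ ξ η : ℝ) (hτ : 0 < τ) :
    Real.exp (2 * τ * |ξ|) ≤ Real.exp (τ * |η|) * Real.exp (τ * |ξ - η|) * Real.exp (τ * |ξ|) := by
  rw [← Real.exp_add, ← Real.exp_add]
  apply Real.exp_le_exp.2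
  have : |ξ| ≤ |η| + |ξ - η| := by
    have := abs_add_le η (ξ - η); simpa using this
  nlinarith

theorem w1 (r τ ξ η : ℝ) (hr : 2 < r) (hτ : 0 < τ) :
    ENNReal.ofReal |ξ - η| * ENNReal.ofReal (Real.exp (2 * τ * |ξ|) * brak ξ ^ (2 * (r - 1/2))) ≤
    ENNReal.ofReal (2 ^ r) * (om τ r η * om τ r (ξ - η) * om τ r ξ * (ji η + ji (ξ - η))) := by
  have hx := brak_pos ξ
  have hy := brak_pos η
  have hz := brak_pos (ξ - η)
  have hy1 := brak_one η
  have hz1 := brak_one (ξ - η)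
  unfold om ji
  rw [← ENNReal.ofReal_add (by positivity) (by positivity), ← ENNReal.ofReal_mul (by positivity),
    ← ENNReal.ofReal_mul (by positivity), ← ENNReal.ofReal_mul (by positivity),
    ← ENNReal.ofReal_mul (by positivity), ← ENNReal.ofReal_mul (by positivity)]
  apply ENNReal.ofReal_le_ofReal
  have h1 := exp_sub τ ξ η hτ
  have h2 : brak ξ ^ (r - 1) ≤ 2 ^ (r - 1) * (brak η ^ (r - 1) + brak (ξ - η) ^ (r - 1)) := by
    have := brak_add_rpow η (ξ - η) (r - 1) (by linarith); simpa using this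
  have h3 := abs_le_brak (ξ - η)
  have e1 : brak ξ ^ (2 * (r - 1/2)) = brak ξ ^ (r - 1) * brak ξ ^ r := by
    rw [← Real.rpow_add hx]; congr 1; ring
  have e2 : brak η ^ r = brak η ^ (r - 1) * brak η := by
    rw [Real.rpow_sub_one hy.ne']; field_simp
  have e3 : brak (ξ - η) ^ r = brak (ξ - η) ^ (r - 1) * brak (ξ - η) := by
    rw [Real.rpow_sub_one hz.ne']; field_simp
  have e4 : (2:ℝ) ^ r = 2 ^ (r - 1) * 2 := by
    rw [Real.rpow_sub_one (by norm_num)]; field_simp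
  have g1 : 1 ≤ brak η ^ (r - 1) := Real.one_le_rpow hy1 (by linarith)
  have g2 : 1 ≤ brak (ξ - η) ^ (r - 1) := Real.one_le_rpow hz1 (by linarith)
  have key : |ξ - η| * brak ξ ^ (r - 1) ≤
      2 ^ r * (brak η ^ r * brak (ξ - η) ^ r * ((brak η)⁻¹ + (brak (ξ - η))⁻¹)) := by
    have : brak η ^ r * brak (ξ - η) ^ r * ((brak η)⁻¹ + (brak (ξ - η))⁻¹) =
       brak η ^ (r-1) * brak (ξ - η) ^ (r-1) * (brak η + brak (ξ - η)) := by
      rw [e2, e3]; field_simp; ring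
    rw [this, e4]
    set a := brak η ^ (r - 1)
    set b := brak (ξ - η) ^ (r - 1)
    calc _ ≤ brak (ξ - η) * (2 ^ (r - 1) * (a + b)) := by gcongr
      _ = 2 ^ (r - 1) * (brak (ξ - η) * (a + b)) := by ring
      _ ≤ 2 ^ (r - 1) * (brak (ξ - η) * (2 * (a * b))) := by
        gcongr; nlinarith
      _ ≤ 2 ^ (r - 1) * 2 * (a * b * (brak η + brak (ξ - η))) := by
        have : 0 ≤ 2 ^ (r - 1) * 2 * (a * b * brak η) := by positivity
        linarith
  calc _ = (|ξ - η| * brak ξ ^ (r - 1)) * Real.exp (2 * τ * |ξ|) * brak ξ ^ r := by rw [e1]; ring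
    _ ≤ (2 ^ r * (brak η ^ r * brak (ξ - η) ^ r * ((brak η)⁻¹ + (brak (ξ - η))⁻¹))) *
      (Real.exp (τ * |η|) * Real.exp (τ * |ξ - η|) * Real.exp (τ * |ξ|)) * brak ξ ^ r := by
        gcongr
    _ = _ := by ring

theorem w2 (r τ ξ η : ℝ) (hr : 2 < r) (hτ : 0 < τ) :
    ENNReal.ofReal |η| * ENNReal.ofReal (Real.exp (2 * τ * |ξ|) * brak ξ ^ (2 * (r - 1/2))) ≤
    ENNReal.ofReal (2 ^ r) * (om τ (r + 1/2) η * om τ (r - 1/2) (ξ - η) * om τ (r - 1/2) ξ *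
      (ji η + ji (ξ - η))) := by
  have hx := brak_pos ξ
  have hy := brak_pos η
  have hz := brak_pos (ξ - η)
  have hy1 := brak_one η
  have hz1 := brak_one (ξ - η)
  unfold om ji
  rw [← ENNReal.ofReal_add (by positivity) (by positivity), ← ENNReal.ofReal_mul (by positivity),
    ← ENNReal.ofReal_mul (by positivity), ← ENNReal.ofReal_mul (by positivity),
    ← ENNReal.ofReal_mul (by positivity), ← ENNReal.ofReal_mul (by positivity)]
  apply ENNReal.ofReal_le_ofReal
  have h1 := exp_sub τ ξ η hτ
  have h2 : brak ξ ^ (r - 1/2) ≤ 2 ^ (r - 1/2) * (brak η ^ (r - 1/2) + brak (ξ - η) ^ (r - 1/2)) := by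
    have := brak_add_rpow η (ξ - η) (r - 1/2) (by linarith); simpa using this
  have h3 := abs_le_brak η
  have e1 : brak ξ ^ (2 * (r - 1/2)) = brak ξ ^ (r - 1/2) * brak ξ ^ (r - 1/2) := by
    rw [← Real.rpow_add hx]; congr 1; ring
  have e2 : brak η ^ (r + 1/2) = brak η ^ (r - 1/2) * brak η := by
    rw [← Real.rpow_add_one hy.ne']; congr 1; ring
  have e4 : (2:ℝ) ^ (r - 1/2) ≤ 2 ^ r := by
    apply Real.rpow_le_rpow_of_exponent_le <;> linarith
  have g1 : brak η ≤ brak η ^ (r - 1/2) := by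
    simpa using Real.rpow_le_rpow_of_exponent_le hy1 (show (1:ℝ) ≤ r - 1/2 by linarith)
  have g2 : brak (ξ - η) ≤ brak (ξ - η) ^ (r - 1/2) := by
    simpa using Real.rpow_le_rpow_of_exponent_le hz1 (show (1:ℝ) ≤ r - 1/2 by linarith)
  have key : |η| * brak ξ ^ (r - 1/2) ≤
      2 ^ r * (brak η ^ (r + 1/2) * brak (ξ - η) ^ (r - 1/2) * ((brak η)⁻¹ + (brak (ξ - η))⁻¹)) := by
    rw [e2]
    set a := brak η ^ (r - 1/2)
    set b := brak (ξ - η) ^ (r - 1/2)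
    have ha : 0 < a := by positivity
    have hb : 0 < b := by positivity
    have : a * brak η * b * ((brak η)⁻¹ + (brak (ξ - η))⁻¹) = a * b + a * brak η * (b / brak (ξ - η)) := by
      field_simp
    rw [this]
    have k1 : 1 ≤ b / brak (ξ - η) := (one_le_div hz).2 g2
    calc _ ≤ brak η * (2 ^ (r - 1/2) * (a + b)) := by gcongr
      _ = 2 ^ (r - 1/2) * (brak η * b + a * brak η * 1) := by ring
      _ ≤ 2 ^ r * (a * b + a * brak η * (b / brak (ξ - η))) := by
        gcongr
  calc _ = (|η| * brak ξ ^ (r - 1/2)) * Real.exp (2 * τ * |ξ|) * brak ξ ^ (r - 1/2) := by rw [e1]; ring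
    _ ≤ (2 ^ r * (brak η ^ (r + 1/2) * brak (ξ - η) ^ (r - 1/2) * ((brak η)⁻¹ + (brak (ξ - η))⁻¹))) *
      (Real.exp (τ * |η|) * Real.exp (τ * |ξ - η|) * Real.exp (τ * |ξ|)) * brak ξ ^ (r - 1/2) := by
        gcongr
    _ = _ := by ring

/-- half line measure -/
abbrev RR : Measure ℝ := (volume : Measure ℝ).restrict (Ioi 0)

/-- weighted modulus -/
def uu (ε t : ℝ) (w : ℝ → ℝ → ℂ) (ξ y : ℝ) : ENNReal := ‖w ξ y‖ₑ * ENNReal.ofReal (rho ε t y)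

theorem om_pos (τ s ξ : ℝ) : om τ s ξ ≠ 0 := by
  have := brak_pos ξ
  unfold om
  rw [Ne, ENNReal.ofReal_eq_zero, not_le]; positivity

theorem om_top (τ s ξ : ℝ) : om τ s ξ ≠ ⊤ := ENNReal.ofReal_ne_top

theorem om_meas (τ s : ℝ) : Measurable (om τ s) := by
  unfold om
  have := brak_cont.measurable
  fun_prop

theorem uu_sq (ε t τ s s' : ℝ) (m : ℝ → ℝ) (w : ℝ → ℝ → ℂ)
    (hms : ∀ ξ, m ξ * brak ξ ^ (2 * s) = brak ξ ^ (2 * s')) (ξ y : ℝ) :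
    (uu ε t w ξ y * om τ s' ξ) ^ (2:ℝ) =
      ENNReal.ofReal (m ξ * ‖w ξ y‖ ^ 2 * wgt ε t τ s ξ y) := by
  have hb := brak_pos ξ
  have hr : 0 < rho ε t y := Real.exp_pos _
  have e : m ξ * ‖w ξ y‖ ^ 2 * wgt ε t τ s ξ y =
      (‖w ξ y‖ * rho ε t y * (Real.exp (τ * |ξ|) * brak ξ ^ s')) ^ 2 := by
    have h1 : brak ξ ^ (2 * s') = (brak ξ ^ s') ^ 2 := by
      rw [← Real.rpow_natCast, ← Real.rpow_mul hb.le]; congr 1; push_cast; ring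
    have h2 : Real.exp (2 * τ * |ξ|) = Real.exp (τ * |ξ|) ^ 2 := by
      rw [← Real.exp_nat_mul]; congr 1; push_cast; ring
    unfold wgt
    calc _ = ‖w ξ y‖ ^ 2 * rho ε t y ^ 2 * Real.exp (2 * τ * |ξ|) * (m ξ * brak ξ ^ (2 * s)) := by
          ring
      _ = _ := by rw [hms, h1, h2]; ring
  rw [e]
  unfold uu om
  rw [← ofReal_norm, ← ENNReal.ofReal_mul (by positivity),
    ← ENNReal.ofReal_mul (by positivity), ENNReal.ofReal_rpow_of_nonneg (by positivity) (by norm_num)]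
  norm_num

theorem uu_meas (ε t τ s s' : ℝ) (m : ℝ → ℝ) (w : ℝ → ℝ → ℂ)
    (hms : ∀ ξ, m ξ * brak ξ ^ (2 * s) = brak ξ ^ (2 * s')) (hfin : wFinite ε t τ s m w) :
    AEMeasurable (fun p : ℝ × ℝ => uu ε t w p.1 p.2) ((volume : Measure ℝ).prod RR) := by
  have h := hfin.aestronglyMeasurable.aemeasurable.ennreal_ofReal
  have h2 := (h.pow_const (1/2 : ℝ)).mul
    ((om_meas τ s').comp measurable_fst).inv.aemeasurable
  refine h2.congr (Eventually.of_forall fun p => ?_)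
  simp only [Pi.mul_apply, Pi.inv_apply, Function.comp]
  rw [← uu_sq ε t τ s s' m w hms, ← ENNReal.rpow_mul]
  norm_num
  rw [mul_assoc, ENNReal.mul_inv_cancel (om_pos _ _ _) (om_top _ _ _), mul_one]

theorem nn_meas {u : ℝ → ℝ → ENNReal}
    (h : AEMeasurable (fun p : ℝ × ℝ => u p.1 p.2) ((volume : Measure ℝ).prod RR)) :
    AEMeasurable (fun ξ => nn RR (u ξ)) := by
  unfold nn
  exact ((h.pow_const (2:ℝ)).lintegral_prod_right').pow_const _

theorem normL (ε t τ s s' : ℝ) (m : ℝ → ℝ) (w : ℝ → ℝ → ℂ) (hm : ∀ ξ, 0 ≤ m ξ)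
    (hms : ∀ ξ, m ξ * brak ξ ^ (2 * s) = brak ξ ^ (2 * s')) (hfin : wFinite ε t τ s m w) :
    nn volume (fun ξ => nn RR (uu ε t w ξ) * om τ s' ξ) =
      ENNReal.ofReal (wNorm ε t τ s m w) := by
  have e : ∀ ξ, (nn RR (uu ε t w ξ) * om τ s' ξ) ^ (2:ℝ) =
      ∫⁻ y in Ioi 0, ENNReal.ofReal (m ξ * ‖w ξ y‖ ^ 2 * wgt ε t τ s ξ y) := by
    intro ξ
    simp_rw [← uu_sq ε t τ s s' m w hms]
    simp_rw [ENNReal.mul_rpow_of_nonneg _ _ (show (0:ℝ) ≤ 2 by norm_num)]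
    rw [lintegral_mul_const' _ _ (ENNReal.rpow_ne_top_of_nonneg (by norm_num) (om_top _ _ _))]
    unfold nn
    rw [← ENNReal.rpow_mul]; norm_num
  have hnn : ∀ ξ y, 0 ≤ m ξ * ‖w ξ y‖ ^ 2 * wgt ε t τ s ξ y := by
    intro ξ y
    have := hm ξ
    have := brak_pos ξ
    unfold wgt
    positivity
  unfold wFinite at hfin
  have e2 : ∫⁻ ξ, ∫⁻ y in Ioi 0, ENNReal.ofReal (m ξ * ‖w ξ y‖ ^ 2 * wgt ε t τ s ξ y) =
      ENNReal.ofReal (∫ ξ : ℝ, ∫ y in Ioi (0 : ℝ), m ξ * ‖w ξ y‖ ^ 2 * wgt ε t τ s ξ y) := by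
    have := integral_prod _ hfin
    simp only at this
    rw [← this, ofReal_integral_eq_lintegral_ofReal hfin (Eventually.of_forall fun p => hnn _ _),
      lintegral_prod _ hfin.aestronglyMeasurable.aemeasurable.ennreal_ofReal]
  unfold nn at e ⊢
  simp_rw [e]
  rw [e2]
  unfold wNorm
  rw [Real.sqrt_eq_rpow, ENNReal.ofReal_rpow_of_nonneg _ (by norm_num)]
  exact integral_nonneg fun ξ => integral_nonneg fun y => hnn _ _

/-- gaussian constant -/
def kap : ENNReal := nn RR (fun y => ENNReal.ofReal (Real.exp (-(1/16) * y ^ 2)))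

theorem kap_top : kap < ⊤ := by
  unfold kap nn
  refine ENNReal.rpow_lt_top_of_nonneg (by norm_num) (ne_of_lt ?_)
  have : ∀ y : ℝ, ENNReal.ofReal (Real.exp (-(1/16) * y ^ 2)) ^ (2:ℝ) =
      ENNReal.ofReal (Real.exp (-(1/8) * y ^ 2)) := by
    intro y
    rw [ENNReal.ofReal_rpow_of_nonneg (Real.exp_pos _).le (by norm_num), ← Real.exp_mul]
    congr 2; ring
  simp_rw [this]
  exact ((integrable_exp_neg_mul_sq (by norm_num)).integrableOn).lintegral_lt_top

theorem rho_ge (ε t y : ℝ) (hε : 0 < ε) (ht : 0 ≤ t) (hte : t ≤ ε) :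
    Real.exp (1/16 * y ^ 2) ≤ rho ε t y := by
  unfold rho
  apply Real.exp_le_exp.2
  have h1 : t / ε ≤ 1 := (div_le_one hε).2 hte
  have h2 : 0 ≤ t / ε := by positivity
  rw [le_div_iff₀ (by positivity)]
  nlinarith [sq_nonneg y]

theorem rho_one (ε t y : ℝ) (hε : 0 < ε) (ht : 0 ≤ t) : 1 ≤ rho ε t y :=
  Real.one_le_exp (by positivity)

theorem rho_meas (ε t : ℝ) : Measurable (rho ε t) := by unfold rho; fun_prop

theorem gauss (ε t : ℝ) (hε : 0 < ε) (ht : 0 ≤ t) (hte : t ≤ ε) (w : ℝ → ℝ → ℂ) (ξ : ℝ)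
    (hw : AEMeasurable (w ξ) RR) :
    ∫⁻ y in Ioi 0, ‖w ξ y‖ₑ ≤ kap * nn RR (uu ε t w ξ) := by
  refine le_trans ?_ (cs RR (by fun_prop) ?_)
  · apply lintegral_mono
    intro y
    simp only [uu]
    calc ‖w ξ y‖ₑ = ‖w ξ y‖ₑ * 1 := by simp
      _ ≤ ‖w ξ y‖ₑ * (ENNReal.ofReal (Real.exp (-(1/16) * y ^ 2)) * ENNReal.ofReal (rho ε t y)) := by
        gcongr
        rw [← ENNReal.ofReal_mul (Real.exp_pos _).le, ← ENNReal.ofReal_one]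
        apply ENNReal.ofReal_le_ofReal
        calc (1:ℝ) = Real.exp (-(1/16) * y ^ 2) * Real.exp (1/16 * y ^ 2) := by
              rw [← Real.exp_add]; simp
          _ ≤ _ := by gcongr; exact rho_ge ε t y hε ht hte
      _ = _ := by ring
  · unfold uu
    exact hw.enorm.mul (rho_meas ε t).ennreal_ofReal.aemeasurable

theorem Iy_bd (ε t : ℝ) (hε : 0 < ε) (ht : 0 ≤ t) (hte : t ≤ ε) (w : ℝ → ℝ → ℂ) (ξ : ℝ)
    (hw : ContDiffOn ℝ 2 (w ξ) (Ici 0)) (y : ℝ) (hy : 0 < y) :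
    ‖Iy (w ξ) y‖ₑ ≤ kap * nn RR (uu ε t w ξ) := by
  refine le_trans ?_ (gauss ε t hε ht hte w ξ
    ((hw.continuousOn.mono Ioi_subset_Ici_self).aemeasurable measurableSet_Ioi))
  unfold Iy
  rw [intervalIntegral.integral_of_le hy.le]
  refine (enorm_integral_le_lintegral_enorm _).trans ?_
  exact lintegral_mono_set Ioc_subset_Ioi_self

theorem sup_bd (ε t : ℝ) (hε : 0 < ε) (ht : 0 ≤ t) (hte : t ≤ ε) (w : ℝ → ℝ → ℂ) (ξ : ℝ)
    (hw : ContDiffOn ℝ 2 (w ξ) (Ici 0)) (hfin : nn RR (uu ε t w ξ) ≠ ⊤) (y : ℝ) (hy : 0 < y) :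
    ‖w ξ y‖ₑ ≤ kap * nn RR (uu ε t (fun ξ y => deriv (w ξ) y) ξ) := by
  refine le_trans ?_ (gauss ε t hε ht hte (fun ξ y => deriv (w ξ) y) ξ
    (measurable_deriv _).aemeasurable)
  set S := ∫⁻ y in Ioi 0, ‖deriv (w ξ) y‖ₑ
  have hw' : ContDiffOn ℝ 2 (w ξ) (Ioi 0) := hw.mono Ioi_subset_Ici_self
  have hd : ContinuousOn (deriv (w ξ)) (Ioi 0) :=
    hw'.continuousOn_deriv_of_isOpen isOpen_Ioi (by norm_num)
  have key : ∀ z, y < z → ‖w ξ y‖ₑ ≤ ‖w ξ z‖ₑ + S := by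
    intro z hz
    have hsub : uIcc y z ⊆ Ioi 0 := by
      rw [uIcc_of_le hz.le]; intro x hx; exact lt_of_lt_of_le hy hx.1
    have hf : ∫ x in y..z, deriv (w ξ) x = w ξ z - w ξ y := by
      apply intervalIntegral.integral_eq_sub_of_hasDerivAt
      · intro x hx
        exact ((hw'.differentiableOn (by norm_num)).differentiableAt
          (isOpen_Ioi.mem_nhds (hsub hx))).hasDerivAt
      · exact (hd.mono hsub).intervalIntegrable
    have h1 : ‖∫ x in y..z, deriv (w ξ) x‖ₑ ≤ S := by
      rw [intervalIntegral.integral_of_le hz.le]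
      refine (enorm_integral_le_lintegral_enorm _).trans ?_
      refine lintegral_mono_set ?_
      intro x hx; exact hy.trans hx.1
    have h2 : w ξ y = w ξ z - ∫ x in y..z, deriv (w ξ) x := by rw [hf]; ring
    calc ‖w ξ y‖ₑ = ‖w ξ z - ∫ x in y..z, deriv (w ξ) x‖ₑ := by rw [← h2]
      _ ≤ _ := enorm_sub_le.trans (by gcongr)
  by_contra hlt
  rw [not_le] at hlt
  apply hfin
  have hδ : 0 < ‖w ξ y‖ₑ - S := tsub_pos_of_lt hlt
  have : ∫⁻ z, uu ε t w ξ z ^ (2:ℝ) ∂(RR) = ⊤ := by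
    rw [eq_top_iff]
    calc (⊤ : ENNReal) = ∫⁻ z in Ioi y, (‖w ξ y‖ₑ - S) ^ (2:ℝ) := by
          rw [setLIntegral_const, Real.volume_Ioi, ENNReal.mul_top]
          exact (ENNReal.rpow_pos_of_nonneg hδ (by norm_num)).ne'
      _ ≤ ∫⁻ z in Ioi y, uu ε t w ξ z ^ (2:ℝ) := by
          apply setLIntegral_mono' measurableSet_Ioi
          intro z hz
          gcongr
          refine (tsub_le_iff_right.2 (key z hz)).trans ?_
          unfold uu
          refine le_mul_of_one_le_right' ?_
          rw [← ENNReal.ofReal_one]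
          exact ENNReal.ofReal_le_ofReal (rho_one ε t z hε ht)
      _ ≤ _ := lintegral_mono_set (Ioi_subset_Ioi hy.le)
  unfold nn
  rw [this]; simp

theorem inner_bd (ξ : ℝ) {U V : ℝ → ℝ → ENNReal} {α β g : ℝ → ENNReal}
    (hU : AEMeasurable (fun p : ℝ × ℝ => U p.1 p.2) ((volume : Measure ℝ).prod RR))
    (hV : AEMeasurable (fun p : ℝ × ℝ => V p.1 p.2) ((volume : Measure ℝ).prod RR))
    (hU1 : ∀ ζ, AEMeasurable (U ζ) RR) (hV1 : ∀ ζ, AEMeasurable (V ζ) RR)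
    (hα : AEMeasurable α) (hβ : AEMeasurable β) (hg : AEMeasurable g RR) :
    ∫⁻ y in Ioi 0, ∫⁻ η, (α η * U (ξ - η) y + β η * V (ξ - η) y) * g y ≤
      ∫⁻ η, (α η * nn RR (U (ξ - η)) + β η * nn RR (V (ξ - η))) * nn RR g := by
  have q : Measure.QuasiMeasurePreserving (fun p : ℝ × ℝ => (ξ - p.2, p.1))
      (RR.prod volume) ((volume : Measure ℝ).prod RR) :=
    ((Measure.measurePreserving_sub_left (volume : Measure ℝ) ξ).prod
      (MeasurePreserving.id RR)).quasiMeasurePreserving.comp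
        Measure.measurePreserving_swap.quasiMeasurePreserving
  have hU2 := hU.comp_quasiMeasurePreserving q
  have hV2 := hV.comp_quasiMeasurePreserving q
  rw [lintegral_lintegral_swap]
  · apply lintegral_mono
    intro η
    simp only
    have e : ∀ y, (α η * U (ξ - η) y + β η * V (ξ - η) y) * g y =
        α η * (U (ξ - η) y * g y) + β η * (V (ξ - η) y * g y) := fun y => by ring
    simp_rw [e]
    have m1 : AEMeasurable (fun y => U (ξ - η) y * g y) RR := (hU1 _).mul hg
    have m2 : AEMeasurable (fun y => V (ξ - η) y * g y) RR := (hV1 _).mul hg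
    rw [lintegral_add_left' (m1.const_mul _), lintegral_const_mul'' _ m1,
      lintegral_const_mul'' _ m2]
    calc _ ≤ α η * (nn RR (U (ξ - η)) * nn RR g) + β η * (nn RR (V (ξ - η)) * nn RR g) := by
          gcongr
          · exact cs _ (hU1 _) hg
          · exact cs _ (hV1 _) hg
      _ = _ := by ring
  · exact ((hα.comp_snd.mul hU2).add (hβ.comp_snd.mul hV2)).mul hg.comp_fst

theorem outer_bd (r τ : ℝ) (hr : 2 < r) (hτ : 0 < τ) {a b c d : ℝ → ENNReal} (k : ENNReal)
    (ha : AEMeasurable a) (hb : AEMeasurable b) (hc : AEMeasurable c) (hd : AEMeasurable d) :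
    ∫⁻ ξ, (∫⁻ η, (k * a η * ENNReal.ofReal |ξ - η| * b (ξ - η) +
        k * c η * ENNReal.ofReal |η| * d (ξ - η)) *
        (b ξ * ENNReal.ofReal (Real.exp (2 * τ * |ξ|) * brak ξ ^ (2 * (r - 1/2))))) ≤
    (k * ENNReal.ofReal (2 ^ r) * (2 * nn volume ji)) *
      (nn volume (fun ξ => a ξ * om τ r ξ) * nn volume (fun ξ => b ξ * om τ r ξ) *
        nn volume (fun ξ => b ξ * om τ r ξ) +
       nn volume (fun ξ => c ξ * om τ (r + 1/2) ξ) * nn volume (fun ξ => d ξ * om τ (r - 1/2) ξ) *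
        nn volume (fun ξ => b ξ * om τ (r - 1/2) ξ)) := by
  have hA := ha.mul (om_meas τ r).aemeasurable
  have hB := hb.mul (om_meas τ r).aemeasurable
  have hB' := hb.mul (om_meas τ (r - 1/2)).aemeasurable
  have hC := hc.mul (om_meas τ (r + 1/2)).aemeasurable
  have hD := hd.mul (om_meas τ (r - 1/2)).aemeasurable
  have t1 := tri hA hB hB
  have t2 := tri hC hD hB'
  have hq : Measure.QuasiMeasurePreserving (fun p : ℝ × ℝ => p.1 - p.2)
    (volume.prod volume) volume := quasiMeasurePreserving_sub volume volume
  have joint : ∀ {f g h : ℝ → ENNReal}, AEMeasurable f → AEMeasurable g → AEMeasurable h →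
      AEMeasurable (fun p : ℝ × ℝ => f p.2 * g (p.1 - p.2) * h p.1 * (ji p.2 + ji (p.1 - p.2)))
        (volume.prod volume) := by
    intro f g h hf hg hh
    exact ((hf.comp_snd.mul (hg.comp_quasiMeasurePreserving hq)).mul hh.comp_fst).mul
      ((ji_meas.comp measurable_snd).add (ji_meas.comp (measurable_fst.sub measurable_snd))).aemeasurable
  have single : ∀ {f g h : ℝ → ENNReal}, AEMeasurable f → AEMeasurable g → AEMeasurable h → ∀ ξ : ℝ,
      AEMeasurable (fun η : ℝ => f η * g (ξ - η) * h ξ * (ji η + ji (ξ - η))) := by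
    intro f g h hf hg hh ξ
    exact ((hf.mul (hg.comp_quasiMeasurePreserving (quasiMeasurePreserving_sub_left volume ξ))).mul_const _).mul
      ((ji_meas).add (ji_meas.comp (measurable_const.sub measurable_id))).aemeasurable
  set F1 : ℝ → ℝ → ENNReal := fun ξ η => (a * om τ r) η * (b * om τ r) (ξ - η) * (b * om τ r) ξ * (ji η + ji (ξ - η)) with hF1
  set F2 : ℝ → ℝ → ENNReal := fun ξ η => (c * om τ (r+1/2)) η * (d * om τ (r-1/2)) (ξ - η) * (b * om τ (r-1/2)) ξ * (ji η + ji (ξ - η)) with hF2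
  have j1 : AEMeasurable (fun p : ℝ × ℝ => F1 p.1 p.2) (volume.prod volume) := joint hA hB hB
  have j2 : AEMeasurable (fun p : ℝ × ℝ => F2 p.1 p.2) (volume.prod volume) := joint hC hD hB'
  have s1 : ∀ ξ, AEMeasurable (F1 ξ) := single hA hB hB
  have s2 : ∀ ξ, AEMeasurable (F2 ξ) := single hC hD hB'
  calc _ ≤ ∫⁻ ξ, ∫⁻ η, (k * ENNReal.ofReal (2 ^ r)) * (F1 ξ η + F2 ξ η) := by
        apply lintegral_mono; intro ξ
        apply lintegral_mono; intro η
        have h1 := w1 r τ ξ η hr hτ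
        have h2 := w2 r τ ξ η hr hτ
        simp only [hF1, hF2, Pi.mul_apply]
        calc _ = k * (a η * b (ξ - η) * b ξ) * (ENNReal.ofReal |ξ - η| * ENNReal.ofReal (Real.exp (2 * τ * |ξ|) * brak ξ ^ (2 * (r - 1/2))))
              + k * (c η * d (ξ - η) * b ξ) * (ENNReal.ofReal |η| * ENNReal.ofReal (Real.exp (2 * τ * |ξ|) * brak ξ ^ (2 * (r - 1/2)))) := by ring
          _ ≤ _ := add_le_add (mul_le_mul_right h1 _) (mul_le_mul_right h2 _)
          _ = _ := by ring
    _ = (k * ENNReal.ofReal (2 ^ r)) * ((∫⁻ ξ, ∫⁻ η, F1 ξ η) + ∫⁻ ξ, ∫⁻ η, F2 ξ η) := by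
        have i1 : AEMeasurable (fun ξ => ∫⁻ η, F1 ξ η) := j1.lintegral_prod_right'
        have i2 : AEMeasurable (fun ξ => ∫⁻ η, F2 ξ η) := j2.lintegral_prod_right'
        have i3 : AEMeasurable (fun ξ => (∫⁻ η, F1 ξ η) + ∫⁻ η, F2 ξ η) := i1.add i2
        have s3 : ∀ ξ, AEMeasurable (fun η => F1 ξ η + F2 ξ η) := fun ξ => (s1 ξ).add (s2 ξ)
        rw [← lintegral_add_left' i1, ← lintegral_const_mul'' _ i3]
        congr 1; ext ξ
        rw [lintegral_const_mul'' _ (s3 ξ), lintegral_add_left' (s1 ξ)]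
    _ ≤ _ := by
        rw [mul_assoc _ (2 * nn volume ji), mul_add (2 * nn volume ji)]
        gcongr
        · exact t1
        · exact t2

/-- **Bound (3.18a) of the paper** on
`T_{∂y𝒩} = ∫∫ ∂_y𝒩_ξ conj(∂_y w̄_ξ) χ² ρ² e^{2τ|ξ|}⟨ξ⟩^{2r−1} dy dξ`. -/
theorem TdyN_bound :
    ∀ r : ℝ, 2 < r →
    ∃ C : ℝ, 0 < C ∧
    ∀ (ε t τ : ℝ), 0 < ε → ε ≤ 1 → 0 ≤ t → t ≤ ε → 0 < τ →
    ∀ χ : ℝ → ℝ, ContDiff ℝ (⊤ : ℕ∞) χ →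
      (∀ y : ℝ, 0 ≤ χ y ∧ χ y ≤ 1) →
      (∀ y : ℝ, y ≤ 1 → χ y = 0) →
      (∀ y : ℝ, 6 ≤ y → χ y = 1) →
      (∀ y : ℝ, 0 ≤ deriv χ y ∧ deriv χ y ≤ 1) →
    ∀ w : ℝ → ℝ → ℂ,
      (∀ ξ : ℝ, ContDiffOn ℝ 2 (w ξ) (Ici 0)) →
      wFinite ε t τ (r - 1 / 2) brak (fun ξ y => ((χ y : ℝ) : ℂ) * deriv (w ξ) y) →
      wFinite ε t τ r (fun _ => 1) (fun ξ y => deriv (w ξ) y) →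
      wFinite ε t τ (r - 1 / 2) (fun _ => 1)
        (fun ξ y => ((χ y : ℝ) : ℂ) * deriv (deriv (w ξ)) y) →
      wFinite ε t τ (r - 1 / 2) (fun _ => 1) (fun ξ y => ((χ y : ℝ) : ℂ) * deriv (w ξ) y) →
      wFinite ε t τ r brak w →
      Integrable (fun q : ℝ × ℝ × ℝ =>
        (w q.2.1 q.2.2 * ((q.1 - q.2.1 : ℝ) : ℂ) * deriv (w (q.1 - q.2.1)) q.2.2
            - (q.2.1 : ℂ) * Iy (w q.2.1) q.2.2 * deriv (deriv (w (q.1 - q.2.1))) q.2.2) *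
          (starRingEnd ℂ) (deriv (w q.1) q.2.2) *
          (((χ q.2.2) ^ 2 * wgt ε t τ (r - 1 / 2) q.1 q.2.2 : ℝ) : ℂ))
        ((volume : Measure ℝ).prod
          ((volume : Measure ℝ).prod ((volume : Measure ℝ).restrict (Ioi 0)))) →
      ‖∫ ξ : ℝ, ∫ y in Ioi (0 : ℝ),
          dyNcal w ξ y * (starRingEnd ℂ) (deriv (w ξ) y) *
            (((χ y) ^ 2 * wgt ε t τ (r - 1 / 2) ξ y : ℝ) : ℂ)‖
        ≤ C * ((wNorm ε t τ (r - 1 / 2) brak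
                (fun ξ y => ((χ y : ℝ) : ℂ) * deriv (w ξ) y)) ^ 2 *
              wNorm ε t τ r (fun _ => 1) (fun ξ y => deriv (w ξ) y)
            + wNorm ε t τ (r - 1 / 2) (fun _ => 1)
                (fun ξ y => ((χ y : ℝ) : ℂ) * deriv (deriv (w ξ)) y) *
              wNorm ε t τ (r - 1 / 2) (fun _ => 1)
                (fun ξ y => ((χ y : ℝ) : ℂ) * deriv (w ξ) y) *
              wNorm ε t τ r brak w) := by
  intro r hr
  set M : ENNReal := kap * ENNReal.ofReal (2 ^ r) * (2 * nn volume ji) with hM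
  have hMt : M ≠ ⊤ := by
    have := kap_top.ne
    have := ji_nn.ne
    finiteness
  refine ⟨M.toReal + 1, by positivity, ?_⟩
  intro ε t τ hε _ ht hte hτ χ hχ hχ1 _ _ _ w hw f1 f2 f3 f4 f5 _
  have hbr : ∀ ξ, brak ξ * brak ξ ^ (2 * (r - 1/2)) = brak ξ ^ (2 * r) := by
    intro ξ
    rw [mul_comm, ← Real.rpow_add_one (brak_pos ξ).ne']; congr 1; ring
  have hbr2 : ∀ ξ, brak ξ * brak ξ ^ (2 * r) = brak ξ ^ (2 * (r + 1/2)) := by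
    intro ξ
    rw [mul_comm, ← Real.rpow_add_one (brak_pos ξ).ne']; congr 1; ring
  have n1 := normL ε t τ _ r _ _ (fun ξ => (brak_pos ξ).le) hbr f1
  have n2 := normL ε t τ _ r _ _ (fun ξ => zero_le_one) (fun ξ => one_mul _) f2
  have n3 := normL ε t τ _ (r - 1/2) _ _ (fun ξ => zero_le_one) (fun ξ => one_mul _) f3
  have n4 := normL ε t τ _ (r - 1/2) _ _ (fun ξ => zero_le_one) (fun ξ => one_mul _) f4
  have n5 := normL ε t τ _ (r + 1/2) _ _ (fun ξ => (brak_pos ξ).le) hbr2 f5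
  have mU := uu_meas ε t τ _ r _ _ hbr f1
  have mA := uu_meas ε t τ _ r _ _ (fun ξ => one_mul _) f2
  have mV := uu_meas ε t τ _ (r - 1/2) _ _ (fun ξ => one_mul _) f3
  have mC := uu_meas ε t τ _ (r + 1/2) _ _ hbr2 f5
  set U := uu ε t (fun ξ y => ((χ y : ℝ) : ℂ) * deriv (w ξ) y) with hU
  set V := uu ε t (fun ξ y => ((χ y : ℝ) : ℂ) * deriv (deriv (w ξ)) y) with hV
  set A := uu ε t (fun ξ y => deriv (w ξ) y) with hA
  have hχm : Measurable χ := hχ.continuous.measurable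
  have hU1 : ∀ ζ, AEMeasurable (U ζ) RR := by
    intro ζ
    have := measurable_deriv (w ζ)
    have := rho_meas ε t
    simp only [hU]; unfold uu
    fun_prop
  have hV1 : ∀ ζ, AEMeasurable (V ζ) RR := by
    intro ζ
    have := measurable_deriv (deriv (w ζ))
    have := rho_meas ε t
    simp only [hV]; unfold uu
    fun_prop
  have ma := nn_meas mA
  have mb := nn_meas mU
  have mc := nn_meas mC
  have md := nn_meas mV
  have hcfin : ∀ᵐ η : ℝ, nn RR (uu ε t w η) ≠ ⊤ := by
    have h1 : ∫⁻ ξ, (nn RR (uu ε t w ξ) * om τ (r + 1/2) ξ) ^ (2:ℝ) ≠ ⊤ := by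
      intro h
      have := n5
      unfold nn at this h
      rw [h] at this
      simp at this
    have h2 := ae_lt_top' ((mc.mul (om_meas τ (r + 1/2)).aemeasurable).pow_const (2:ℝ)) h1
    filter_upwards [h2] with η hη htop
    simp only [Pi.mul_apply] at hη
    rw [htop, ENNReal.top_mul (om_pos _ _ _)] at hη
    simp at hη
  -- the main bound
  have main : ‖∫ ξ : ℝ, ∫ y in Ioi (0 : ℝ),
          dyNcal w ξ y * (starRingEnd ℂ) (deriv (w ξ) y) *
            (((χ y) ^ 2 * wgt ε t τ (r - 1 / 2) ξ y : ℝ) : ℂ)‖ₑ ≤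
      ∫⁻ ξ, (∫⁻ η, (kap * nn RR (A η) * ENNReal.ofReal |ξ - η| * nn RR (U (ξ - η)) +
        kap * nn RR (uu ε t w η) * ENNReal.ofReal |η| * nn RR (V (ξ - η))) *
        (nn RR (U ξ) * ENNReal.ofReal (Real.exp (2 * τ * |ξ|) * brak ξ ^ (2 * (r - 1/2))))) := by
    refine (enorm_integral_le_lintegral_enorm _).trans (lintegral_mono fun ξ => ?_)
    refine (enorm_integral_le_lintegral_enorm _).trans ?_
    set E := ENNReal.ofReal (Real.exp (2 * τ * |ξ|) * brak ξ ^ (2 * (r - 1/2))) with hE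
    have hnE : nn RR (fun y => U ξ y * E) = nn RR (U ξ) * E := by
      unfold nn
      simp_rw [ENNReal.mul_rpow_of_nonneg _ _ (show (0:ℝ) ≤ 2 by norm_num)]
      rw [lintegral_mul_const' _ _ (ENNReal.rpow_ne_top_of_nonneg (by norm_num) ENNReal.ofReal_ne_top),
        ENNReal.mul_rpow_of_nonneg _ _ (by norm_num), ← ENNReal.rpow_mul E]
      norm_num
    have hin := inner_bd ξ (α := fun η => kap * nn RR (A η) * ENNReal.ofReal |ξ - η|)
      (β := fun η => kap * nn RR (uu ε t w η) * ENNReal.ofReal |η|) (g := fun y => U ξ y * E)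
      mU mV hU1 hV1 ((ma.const_mul _).mul (by fun_prop)) ((mc.const_mul _).mul (by fun_prop))
      ((hU1 ξ).mul_const _)
    rw [hnE] at hin
    refine le_trans ?_ hin
    apply setLIntegral_mono' measurableSet_Ioi
    intro y hy
    have hy0 : 0 < y := hy
    have hχ0 := (hχ1 y).1
    have hρ : 0 < rho ε t y := Real.exp_pos _
    rw [enorm_mul, enorm_mul]
    set X := ENNReal.ofReal (χ y) with hX
    set P := ENNReal.ofReal (rho ε t y) with hP
    have eχ : ‖((χ y : ℝ) : ℂ)‖ₑ = X := by
      rw [← ofReal_norm, Complex.norm_real, Real.norm_of_nonneg hχ0]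
    have ew : ‖(((χ y) ^ 2 * wgt ε t τ (r - 1 / 2) ξ y : ℝ) : ℂ)‖ₑ = X * X * (P * P * E) := by
      have hb := brak_pos ξ
      rw [← ofReal_norm, Complex.norm_real, Real.norm_of_nonneg (by unfold wgt; positivity),
        hX, hP, hE, ← ENNReal.ofReal_mul hχ0, ← ENNReal.ofReal_mul hρ.le,
        ← ENNReal.ofReal_mul (by positivity), ← ENNReal.ofReal_mul (by positivity)]
      congr 1
      unfold wgt; ring
    have ec : ‖(starRingEnd ℂ) (deriv (w ξ) y)‖ₑ = ‖deriv (w ξ) y‖ₑ := by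
      rw [← ofReal_norm, RCLike.norm_conj, ofReal_norm]
    rw [ew, ec]
    have hdN : ‖dyNcal w ξ y‖ₑ ≤ ∫⁻ η, (kap * nn RR (A η) * ENNReal.ofReal |ξ - η| *
        ‖deriv (w (ξ - η)) y‖ₑ + kap * nn RR (uu ε t w η) * ENNReal.ofReal |η| *
        ‖deriv (deriv (w (ξ - η))) y‖ₑ) := by
      unfold dyNcal
      rw [enorm_mul]
      have : ‖Complex.I‖ₑ = 1 := by rw [← ofReal_norm]; simp
      rw [this, one_mul]
      refine (enorm_integral_le_lintegral_enorm _).trans (lintegral_mono_ae ?_)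
      filter_upwards [hcfin] with η hη
      have b1 := sup_bd ε t hε ht hte w η (hw η) hη y hy0
      have b2 := Iy_bd ε t hε ht hte w η (hw η) y hy0
      have er : ∀ x : ℝ, ‖(x : ℂ)‖ₑ = ENNReal.ofReal |x| := by
        intro x; rw [← ofReal_norm, Complex.norm_real, Real.norm_eq_abs]
      refine enorm_sub_le.trans ?_
      rw [enorm_mul, enorm_mul, enorm_mul, enorm_mul, er, er]
      refine add_le_add ?_ ?_
      · gcongr
      · rw [mul_comm (ENNReal.ofReal |η|)]
        gcongr
    refine (mul_le_mul_left (mul_le_mul_left hdN _) _).trans ?_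
    rw [mul_assoc, ← lintegral_mul_const' _ _ (by finiteness)]
    apply lintegral_mono
    intro η
    simp only [hU, hV]
    unfold uu
    simp only [enorm_mul, eχ]
    rw [← hP]
    apply le_of_eq
    ring
  have fin := main.trans (outer_bd r τ hr hτ kap ma mb mc md)
  rw [n1, n2, n3, n4, n5, ← hM] at fin
  have p1 : 0 ≤ wNorm ε t τ (r - 1 / 2) brak (fun ξ y => ((χ y : ℝ) : ℂ) * deriv (w ξ) y) :=
    Real.sqrt_nonneg _
  have p2 : 0 ≤ wNorm ε t τ r (fun _ => 1) (fun ξ y => deriv (w ξ) y) := Real.sqrt_nonneg _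
  have p3 : 0 ≤ wNorm ε t τ (r - 1 / 2) (fun _ => 1)
    (fun ξ y => ((χ y : ℝ) : ℂ) * deriv (deriv (w ξ)) y) := Real.sqrt_nonneg _
  have p4 : 0 ≤ wNorm ε t τ (r - 1 / 2) (fun _ => 1)
    (fun ξ y => ((χ y : ℝ) : ℂ) * deriv (w ξ) y) := Real.sqrt_nonneg _
  have p5 : 0 ≤ wNorm ε t τ r brak w := Real.sqrt_nonneg _
  rw [← ENNReal.ofReal_toReal hMt, ← ENNReal.ofReal_mul p2, ← ENNReal.ofReal_mul (by positivity),
    ← ENNReal.ofReal_mul p5, ← ENNReal.ofReal_mul (by positivity),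
    ← ENNReal.ofReal_add (by positivity) (by positivity), ← ENNReal.ofReal_mul (by positivity),
    ← ofReal_norm, ENNReal.ofReal_le_ofReal_iff (by positivity)] at fin
  refine fin.trans ?_
  have hMM : M.toReal ≤ M.toReal + 1 := by linarith
  refine le_trans (le_of_eq ?_) (mul_le_mul_of_nonneg_right hMM (by positivity))
  ring
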